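/- For every simplicial complex K (with a chosen base vertex) and every integer m ≥ 1, scat_m(K) ≤ TC^m(K). -/

import Mathlib

noncomputable section
open scoped Classical

/-- An abstract simplicial complex on vertex type `V`: a collection of nonempty
finite subsets (simplices) closed under passing to nonempty subsets. -/
structure SComplex (V : Type) where
  faces : Set (Finset V)
  nonempty_of_mem : ∀ σ ∈ faces, σ.Nonempty
  down_closed : ∀ σ ∈ faces, ∀ τ ⊆ σ, τ.Nonempty → τ ∈ faces

namespace SComplex

/-- `f` is a simplicial map from `K` to `L`. -/
def IsSimplicialMap {V W : Type} (K : SComplex V) (L : SComplex W) (f : V → W) : Prop :=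
  ∀ σ ∈ K.faces, σ.image f ∈ L.faces

/-- `f` and `g` are contiguous as maps from `K` to `L`. -/
def Contiguous {V W : Type} (K : SComplex V) (L : SComplex W) (f g : V → W) : Prop :=
  ∀ σ ∈ K.faces, σ.image f ∪ σ.image g ∈ L.faces

/-- `f` and `g` are in the same contiguity class: there is a finite chain of
simplicial maps from `f` to `g` in which consecutive maps are contiguous. -/
def SameClass {V W : Type} (K : SComplex V) (L : SComplex W) (f g : V → W) : Prop :=
  Relation.ReflTransGen
    (fun a b => K.IsSimplicialMap L a ∧ K.IsSimplicialMap L b ∧ K.Contiguous L a b) f g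

/-- `K'` is a subcomplex of `K`. -/
def IsSubcomplex {V : Type} (K' K : SComplex V) : Prop :=
  K'.faces ⊆ K.faces

/-- `Ks` is a covering of `K` by subcomplexes. -/
def Covers {V : Type} (K : SComplex V) {k : ℕ} (Ks : Fin (k + 1) → SComplex V) : Prop :=
  (∀ j, (Ks j).IsSubcomplex K) ∧ ∀ σ ∈ K.faces, ∃ j, σ ∈ (Ks j).faces

/-- `P` has dimension at most `m`. -/
def DimLE {U : Type} (P : SComplex U) (m : ℕ) : Prop :=
  ∀ σ ∈ P.faces, σ.card ≤ m + 1

/-- The `m`-contiguity distance `SD_m(φ, ψ)`. -/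
noncomputable def SDm {V W : Type} (m : ℕ) (K : SComplex V) (L : SComplex W)
    (φ ψ : V → W) : ℕ∞ :=
  sInf {n : ℕ∞ | ∃ k : ℕ, n = (k : ℕ∞) ∧ ∃ Ks : Fin (k + 1) → SComplex V, K.Covers Ks ∧
    ∀ j, ∀ (P : Type) (PC : SComplex P), PC.DimLE m →
      ∀ η : P → V, PC.IsSimplicialMap (Ks j) η → PC.SameClass L (φ ∘ η) (ψ ∘ η)}

/-- The contiguity distance `SD(φ, ψ)`. -/
noncomputable def SD {V W : Type} (K : SComplex V) (L : SComplex W) (φ ψ : V → W) : ℕ∞ :=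
  sInf {n : ℕ∞ | ∃ k : ℕ, n = (k : ℕ∞) ∧ ∃ Ks : Fin (k + 1) → SComplex V, K.Covers Ks ∧
    ∀ j, (Ks j).SameClass L φ ψ}

/-- The `m`-simplicial Lusternik–Schnirelmann category `scat_m(K)`. -/
noncomputable def scatm {V : Type} (m : ℕ) (K : SComplex V) : ℕ∞ :=
  sInf {n : ℕ∞ | ∃ k : ℕ, n = (k : ℕ∞) ∧ ∃ Ks : Fin (k + 1) → SComplex V, K.Covers Ks ∧
    ∀ j, ∀ (P : Type) (PC : SComplex P), PC.DimLE m →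
      ∀ η : P → V, PC.IsSimplicialMap (Ks j) η →
        ∃ v0 : V, PC.SameClass K η (fun _ => v0)}

/-- The simplicial Lusternik–Schnirelmann category `scat(K)`. -/
noncomputable def scat {V : Type} (K : SComplex V) : ℕ∞ :=
  sInf {n : ℕ∞ | ∃ k : ℕ, n = (k : ℕ∞) ∧ ∃ Ks : Fin (k + 1) → SComplex V, K.Covers Ks ∧
    ∀ j, ∃ v0 : V, (Ks j).SameClass K id (fun _ => v0)}

/-- The categorical product of two simplicial complexes. -/
def prod {V W : Type} (K : SComplex V) (L : SComplex W) : SComplex (V × W) where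
  faces := {σ | σ.Nonempty ∧ σ.image Prod.fst ∈ K.faces ∧ σ.image Prod.snd ∈ L.faces}
  nonempty_of_mem := fun _ h => h.1
  down_closed := by
    rintro σ ⟨-, h1, h2⟩ τ hτσ hτ
    exact ⟨hτ, K.down_closed _ h1 _ (Finset.image_subset_image hτσ) (hτ.image _),
      L.down_closed _ h2 _ (Finset.image_subset_image hτσ) (hτ.image _)⟩

/-- The barycentric subdivision: vertices are the simplices of `K`, simplices are
the chains of simplices of `K` (totally ordered by inclusion). -/
def sd {V : Type} (K : SComplex V) : SComplex (Finset V) where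
  faces := {S | S.Nonempty ∧ (∀ σ ∈ S, σ ∈ K.faces) ∧ ∀ σ ∈ S, ∀ τ ∈ S, σ ⊆ τ ∨ τ ⊆ σ}
  nonempty_of_mem := fun _ h => h.1
  down_closed := by
    rintro S ⟨-, h1, h2⟩ T hTS hT
    exact ⟨hT, fun σ hσ => h1 σ (hTS hσ), fun σ hσ τ hτ => h2 σ (hTS hσ) τ (hTS hτ)⟩

/-- The map induced on barycentric subdivisions: `sd(f)(σ) = f(σ)`. -/
def sdMap {V W : Type} (f : V → W) : Finset V → Finset W :=
  fun σ => σ.image f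

/-- The `m`-dimensional simplicial Švarc genus `secat_m(φ)`. -/
noncomputable def secatm {V W : Type} (m : ℕ) (K : SComplex V) (L : SComplex W)
    (φ : V → W) : ℕ∞ :=
  sInf {n : ℕ∞ | ∃ k : ℕ, n = (k : ℕ∞) ∧ ∃ Ls : Fin (k + 1) → SComplex W, L.Covers Ls ∧
    ∀ j, ∀ (P : Type) (PC : SComplex P), PC.DimLE m →
      ∀ η : P → W, PC.IsSimplicialMap (Ls j) η →
        ∃ s : P → V, PC.IsSimplicialMap K s ∧ φ ∘ s = η}

/-- The `m`-dimensional homotopy simplicial Švarc genus `hsecat_m(φ)`. -/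
noncomputable def hsecatm {V W : Type} (m : ℕ) (K : SComplex V) (L : SComplex W)
    (φ : V → W) : ℕ∞ :=
  sInf {n : ℕ∞ | ∃ k : ℕ, n = (k : ℕ∞) ∧ ∃ Ls : Fin (k + 1) → SComplex W, L.Covers Ls ∧
    ∀ j, ∀ (P : Type) (PC : SComplex P), PC.DimLE m →
      ∀ η : P → W, PC.IsSimplicialMap (Ls j) η →
        ∃ s : P → V, PC.IsSimplicialMap K s ∧ PC.SameClass L (φ ∘ s) η}

/-- The `m`-simplicial LS category `scat_m(φ)` of a simplicial map `φ : K → L`. -/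
noncomputable def scatmMap {V W : Type} (m : ℕ) (K : SComplex V) (L : SComplex W)
    (φ : V → W) : ℕ∞ :=
  sInf {n : ℕ∞ | ∃ k : ℕ, n = (k : ℕ∞) ∧ ∃ Ks : Fin (k + 1) → SComplex V, K.Covers Ks ∧
    ∀ j, ∀ (P : Type) (PC : SComplex P), PC.DimLE m →
      ∀ η : P → V, PC.IsSimplicialMap (Ks j) η →
        ∃ w0 : W, PC.SameClass L (φ ∘ η) (fun _ => w0)}

/-- `p : E → B` is a simplicial fibration. -/
def IsFibration {Ve Vb : Type} (E : SComplex Ve) (B : SComplex Vb) (p : Ve → Vb) : Prop :=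
  ∀ (X : Type) (KC : SComplex X) (ℓ : ℕ) (φs : Fin (ℓ + 1) → X → Vb),
    (∀ i, KC.IsSimplicialMap B (φs i)) →
    (∀ i : Fin ℓ, KC.Contiguous B (φs i.castSucc) (φs i.succ)) →
    ∀ φt : X → Ve, KC.IsSimplicialMap E φt → p ∘ φt = φs 0 →
      ∃ φts : Fin (ℓ + 1) → X → Ve, φts 0 = φt ∧
        (∀ i, KC.IsSimplicialMap E (φts i)) ∧
        (∀ i : Fin ℓ, KC.Contiguous E (φts i.castSucc) (φts i.succ)) ∧
        ∀ i, p ∘ φts i = φs i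

/-- `β : K → M` is a strong equivalence. -/
def IsStrongEquivalence {V U : Type} (K : SComplex V) (M : SComplex U) (β : V → U) : Prop :=
  K.IsSimplicialMap M β ∧ ∃ δ : U → V, M.IsSimplicialMap K δ ∧
    K.SameClass K (δ ∘ β) id ∧ M.SameClass M (β ∘ δ) id

/-- The diagonal map `Δ : V → V × V`. -/
def diag (V : Type) : V → V × V := fun v => (v, v)

/-- The `m`-discrete topological complexity `TC^m(K)`. -/
noncomputable def TCm {V : Type} (m : ℕ) (K : SComplex V) : ℕ∞ :=
  sInf {n : ℕ∞ | ∃ k : ℕ, n = (k : ℕ∞) ∧ ∃ Ωs : Fin (k + 1) → SComplex (V × V),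
    (K.prod K).Covers Ωs ∧
    ∀ j, ∃ σj : V × V → V, (Ωs j).IsSimplicialMap K σj ∧
      ∀ (P : Type) (PC : SComplex P), PC.DimLE m →
        ∀ η : P → V × V, PC.IsSimplicialMap (Ωs j) η →
          PC.SameClass (K.prod K) (diag V ∘ σj ∘ η) η}

/-- The discrete topological complexity `TC(K)`. -/
noncomputable def TC {V : Type} (K : SComplex V) : ℕ∞ :=
  sInf {n : ℕ∞ | ∃ k : ℕ, n = (k : ℕ∞) ∧ ∃ Ωs : Fin (k + 1) → SComplex (V × V),
    (K.prod K).Covers Ωs ∧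
    ∀ j, ∃ σj : V × V → V, (Ωs j).IsSimplicialMap K σj ∧
      (Ωs j).SameClass (K.prod K) (diag V ∘ σj) id}

end SComplex

namespace SComplex

theorem SameClass.symm {V W : Type} {K : SComplex V} {L : SComplex W} {f g : V → W}
    (h : K.SameClass L f g) : K.SameClass L g f := by
  refine Relation.ReflTransGen.mono ?_ _ _ (Relation.ReflTransGen.swap _ _ h)
  rintro a b ⟨hb, ha, hab⟩
  exact ⟨ha, hb, fun σ hσ => by rw [Finset.union_comm]; exact hab σ hσ⟩

theorem IsSimplicialMap.comp {U V W : Type} {K : SComplex U} {L : SComplex V} {M : SComplex W}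
    {p : V → W} {f : U → V} (hp : L.IsSimplicialMap M p) (hf : K.IsSimplicialMap L f) :
    K.IsSimplicialMap M (p ∘ f) := fun σ hσ => by
  rw [← Finset.image_image]
  exact hp _ (hf σ hσ)

theorem SameClass.comp_left {U V W : Type} {K : SComplex U} {L : SComplex V} {M : SComplex W}
    {p : V → W} {f g : U → V} (hp : L.IsSimplicialMap M p) (h : K.SameClass L f g) :
    K.SameClass M (p ∘ f) (p ∘ g) := by
  refine Relation.ReflTransGen.lift (p := fun a b : U → W =>
    K.IsSimplicialMap M a ∧ K.IsSimplicialMap M b ∧ K.Contiguous M a b) (fun a => p ∘ a) ?_ _ _ h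
  rintro a b ⟨ha, hb, hab⟩
  refine ⟨hp.comp ha, hp.comp hb, fun σ hσ => ?_⟩
  rw [← Finset.image_image, ← Finset.image_image, ← Finset.image_union]
  exact hp _ (hab σ hσ)

theorem isSimplicialMap_fst {V W : Type} (K : SComplex V) (L : SComplex W) :
    (K.prod L).IsSimplicialMap K Prod.fst := fun _ h => h.2.1

theorem isSimplicialMap_snd {V W : Type} (K : SComplex V) (L : SComplex W) :
    (K.prod L).IsSimplicialMap L Prod.snd := fun _ h => h.2.2

theorem isSimplicialMap_prodMk_const {V W : Type} (K : SComplex V) (L : SComplex W) {w : W}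
    (hw : {w} ∈ L.faces) : K.IsSimplicialMap (K.prod L) (fun v => (v, w)) := by
  intro σ hσ
  have hne := K.nonempty_of_mem σ hσ
  refine ⟨by simpa using hne, ?_, ?_⟩
  · convert hσ
    ext
    simp
  · convert hw
    rw [← Finset.image_const hne w]
    ext
    simp

/-- The subcomplex of `K` of simplices mapped by `f` into `L`. -/
def preimage {V W : Type} (K : SComplex V) (L : SComplex W) (f : V → W) : SComplex V where
  faces := {σ | σ ∈ K.faces ∧ σ.image f ∈ L.faces}
  nonempty_of_mem := fun σ h => K.nonempty_of_mem σ h.1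
  down_closed := fun σ h τ hτσ hτ =>
    ⟨K.down_closed σ h.1 τ hτσ hτ,
      L.down_closed _ h.2 _ (Finset.image_subset_image hτσ) (hτ.image f)⟩

theorem isSimplicialMap_preimage {V W : Type} (K : SComplex V) (L : SComplex W) (f : V → W) :
    (K.preimage L f).IsSimplicialMap L f := fun _ h => h.2

theorem Covers.preimage {V W : Type} {K : SComplex V} {L : SComplex W} {k : ℕ}
    {Ls : Fin (k + 1) → SComplex W} (h : L.Covers Ls) {f : V → W} (hf : K.IsSimplicialMap L f) :
    K.Covers fun j => K.preimage (Ls j) f :=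
  ⟨fun _ _ hσ => hσ.1, fun σ hσ => (h.2 _ (hf σ hσ)).imp fun _ hj => ⟨hσ, hj⟩⟩

end SComplex

open SComplex

/-- `scat_m(K) ≤ TC^m(K)`. -/
theorem scatm_le_TCm {V : Type} (K : SComplex V) (v0 : V) (hv0 : {v0} ∈ K.faces)
    (m : ℕ) (hm : 1 ≤ m) :
    scatm m K ≤ TCm m K := by
  refine le_sInf ?_
  rintro _ ⟨k, rfl, Ωs, hΩ, hσ⟩
  refine sInf_le ⟨k, rfl, fun j => K.preimage (Ωs j) (fun v => (v, v0)),
    hΩ.preimage (isSimplicialMap_prodMk_const K K hv0), fun j P PC hP η hη => ⟨v0, ?_⟩⟩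
  obtain ⟨s, -, hs⟩ := hσ j
  have h := hs P PC hP _ ((isSimplicialMap_preimage K (Ωs j) _).comp hη)
  exact (h.comp_left (isSimplicialMap_fst K K)).symm.trans
    (h.comp_left (isSimplicialMap_snd K K))
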